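/- arXiv:1204.4031 — 6 statements merged into one kernel-verified Lean document; each statement's English description precedes it below -/
import Mathlib

section
/- Let ε > 0 and k > 0, and let a, b ∈ ℝ with |a − b| ≤ k. Let Lap(k/ε) denote the Laplace measure on ℝ with density x ↦ (ε/(2k))·exp(−ε|x|/k) with respect to Lebesgue measure. Then the pushforwards of Lap(k/ε) under the translations x ↦ x + a and x ↦ x + b are ε-mutually bounded: for every Borel set I ⊆ ℝ, each of the two translated measures assigns I at most e^ε times the mass the other assigns to I. -/
open MeasureTheory

/-- The Laplace measure `Lap(b)` on `ℝ`, with density `x ↦ (1/(2b))·exp(−|x|/b)`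
with respect to Lebesgue measure. -/
noncomputable def laplaceMeasure (b : ℝ) : Measure ℝ :=
  volume.withDensity (fun x => ENNReal.ofReal ((1 / (2 * b)) * Real.exp (-|x| / b)))

/-- The translate of `Lap(s)` by `a` has density `x ↦ (1/(2s))·exp(−|x − a|/s)`. -/
theorem laplaceMeasure_map_add_right_apply (s a : ℝ) {I : Set ℝ} (hI : MeasurableSet I) :
    ((laplaceMeasure s).map (fun x => x + a)) I =
      ∫⁻ x in I, ENNReal.ofReal ((1 / (2 * s)) * Real.exp (-|x - a| / s)) := by
  have hadd : Measurable fun x : ℝ => x + a := by fun_prop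
  rw [Measure.map_apply hadd hI, laplaceMeasure, withDensity_apply _ (hadd hI),
    ← (measurePreserving_add_right volume a).setLIntegral_comp_preimage hI (by fun_prop)]
  simp only [add_sub_cancel_right]

/-- Translating `Lap(s)` by `a` instead of `b` changes masses by a factor of at most `e^ε`
when `|a − b| ≤ ε s`. -/
theorem laplaceMeasure_map_add_right_le {s ε a b : ℝ} (hs : 0 < s) (hab : |a - b| ≤ ε * s)
    {I : Set ℝ} (hI : MeasurableSet I) :
    ((laplaceMeasure s).map (fun x => x + a)) I ≤
      ENNReal.ofReal (Real.exp ε) * ((laplaceMeasure s).map (fun x => x + b)) I := by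
  rw [laplaceMeasure_map_add_right_apply s a hI, laplaceMeasure_map_add_right_apply s b hI,
    ← lintegral_const_mul _ (by fun_prop)]
  refine lintegral_mono fun x => ?_
  rw [← ENNReal.ofReal_mul (Real.exp_pos ε).le, mul_left_comm, ← Real.exp_add]
  gcongr
  rw [div_le_iff₀ hs, add_mul, div_mul_cancel₀ _ hs.ne']
  have h := abs_sub_le x a b
  linarith

/-- If `|a − b| ≤ k`, then the pushforwards of `Lap(k/ε)` under the translations
`x ↦ x + a` and `x ↦ x + b` are `ε`-mutually bounded. -/
theorem laplace_translate_mutuallyBounded (ε k a b : ℝ) (hε : 0 < ε) (hk : 0 < k)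
    (hab : |a - b| ≤ k) :
    ∀ I : Set ℝ, MeasurableSet I →
      ((laplaceMeasure (k / ε)).map (fun x => x + a)) I ≤
          ENNReal.ofReal (Real.exp ε) * ((laplaceMeasure (k / ε)).map (fun x => x + b)) I ∧
      ((laplaceMeasure (k / ε)).map (fun x => x + b)) I ≤
          ENNReal.ofReal (Real.exp ε) * ((laplaceMeasure (k / ε)).map (fun x => x + a)) I := by
  have hs : 0 < k / ε := div_pos hk hε
  have hεs : ε * (k / ε) = k := mul_div_cancel₀ k hε.ne'
  exact fun I hI => ⟨laplaceMeasure_map_add_right_le hs (hεs.symm ▸ hab) hI,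
    laplaceMeasure_map_add_right_le hs (by rwa [hεs, abs_sub_comm]) hI⟩
end

section
/- Let ε > 0 and k > 0. Let (Ω, P) be a probability space and let M₁, M₂ : Ω → ℝ be random variables with |M₁(ω) − M₂(ω)| ≤ k almost surely. Let L : Ω → ℝ be a random variable whose law is the Laplace measure with density x ↦ (ε/(2k))·exp(−ε|x|/k), such that L is independent of the pair (M₁, M₂). Then the laws of M₁ + L and M₂ + L are ε-mutually bounded: for every Borel set I ⊆ ℝ, P(M₁ + L ∈ I) ≤ e^ε · P(M₂ + L ∈ I) and P(M₂ + L ∈ I) ≤ e^ε · P(M₁ + L ∈ I). -/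
open MeasureTheory ProbabilityTheory

/-- Translation changes the Laplace measure by at most the factor `exp (|a - c| / b)`. -/
theorem laplaceMeasure_preimage_add_le {b : ℝ} (hb : 0 < b) (a c : ℝ) {I : Set ℝ}
    (hI : MeasurableSet I) :
    laplaceMeasure b ((a + ·) ⁻¹' I) ≤
      ENNReal.ofReal (Real.exp (|a - c| / b)) * laplaceMeasure b ((c + ·) ⁻¹' I) := by
  have translate (d : ℝ) : laplaceMeasure b ((d + ·) ⁻¹' I) =
      ∫⁻ y in I, ENNReal.ofReal ((1 / (2 * b)) * Real.exp (-|-d + y| / b)) := by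
    rw [laplaceMeasure, withDensity_apply _ (measurable_const_add d hI),
      ← (measurePreserving_add_left volume d).setLIntegral_comp_preimage hI (by fun_prop)]
    simp
  rw [translate, translate, ← lintegral_const_mul _ (by fun_prop)]
  refine lintegral_mono fun y => ?_
  dsimp only
  rw [← ENNReal.ofReal_mul (Real.exp_pos _).le, mul_left_comm, ← Real.exp_add, ← add_div]
  gcongr
  have h := abs_sub_le (y - c) (y - a) 0
  have e : y - c - (y - a) = a - c := by ring
  rw [e, sub_zero, sub_zero] at h
  rw [neg_add_eq_sub, neg_add_eq_sub]
  linarith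

/-- The law of a sum of independent real random variables, by conditioning on the first one. -/
theorem ProbabilityTheory.IndepFun.measure_add_mem_eq_lintegral {Ω : Type*} [MeasurableSpace Ω]
    {P : Measure Ω} [IsFiniteMeasure P] {X L : Ω → ℝ} (hX : Measurable X) (hL : Measurable L)
    (h : IndepFun X L P) {I : Set ℝ} (hI : MeasurableSet I) :
    P {ω | X ω + L ω ∈ I} = ∫⁻ ω, P.map L ((X ω + ·) ⁻¹' I) ∂P := by
  have hS : MeasurableSet ((fun p : ℝ × ℝ => p.1 + p.2) ⁻¹' I) := measurable_add hI
  calc P {ω | X ω + L ω ∈ I}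
      = P.map (fun ω => (X ω, L ω)) ((fun p : ℝ × ℝ => p.1 + p.2) ⁻¹' I) :=
        (Measure.map_apply (hX.prodMk hL) hS).symm
    _ = ∫⁻ x, P.map L ((x + ·) ⁻¹' I) ∂(P.map X) := by
        rw [h.map_prod_eq_prod_map_map hX.aemeasurable hL.aemeasurable, Measure.prod_apply hS]
        rfl
    _ = ∫⁻ ω, P.map L ((X ω + ·) ⁻¹' I) ∂P :=
        lintegral_map (measurable_measure_prodMk_left hS) hX

/-- One of the two inequalities defining mutual boundedness. -/
theorem measure_add_laplace_mem_le {Ω : Type*} [MeasurableSpace Ω]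
    {P : Measure Ω} [IsFiniteMeasure P] {ε k : ℝ} (hε : 0 < ε) (hk : 0 < k)
    {X Y L : Ω → ℝ} (hX : Measurable X) (hY : Measurable Y) (hL : Measurable L)
    (hbd : ∀ᵐ ω ∂P, |X ω - Y ω| ≤ k) (hlaw : P.map L = laplaceMeasure (k / ε))
    (hXL : IndepFun X L P) (hYL : IndepFun Y L P) {I : Set ℝ} (hI : MeasurableSet I) :
    P {ω | X ω + L ω ∈ I} ≤ ENNReal.ofReal (Real.exp ε) * P {ω | Y ω + L ω ∈ I} := by
  rw [hXL.measure_add_mem_eq_lintegral hX hL hI, hYL.measure_add_mem_eq_lintegral hY hL hI,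
    ← lintegral_const_mul' _ _ ENNReal.ofReal_ne_top, hlaw]
  refine lintegral_mono_ae ?_
  filter_upwards [hbd] with ω hω
  refine (laplaceMeasure_preimage_add_le (div_pos hk hε) (X ω) (Y ω) hI).trans ?_
  gcongr
  rw [div_div_eq_mul_div, div_le_iff₀ hk, mul_comm ε]
  gcongr

/-- If `|M₁ − M₂| ≤ k` almost surely and `L` is Laplace with parameter `k/ε`
(density `x ↦ (ε/(2k))·exp(−ε|x|/k)`), independent of the pair `(M₁, M₂)`, then the
laws of `M₁ + L` and `M₂ + L` are `ε`-mutually bounded. -/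
theorem laplace_noise_mutuallyBounded {Ω : Type*} [MeasurableSpace Ω]
    (P : Measure Ω) [IsProbabilityMeasure P]
    (ε k : ℝ) (hε : 0 < ε) (hk : 0 < k)
    (M₁ M₂ L : Ω → ℝ) (hM₁ : Measurable M₁) (hM₂ : Measurable M₂) (hL : Measurable L)
    (hbd : ∀ᵐ ω ∂P, |M₁ ω - M₂ ω| ≤ k)
    (hlaw : P.map L = laplaceMeasure (k / ε))
    (hindep : IndepFun L (fun ω => (M₁ ω, M₂ ω)) P) :
    ∀ I : Set ℝ, MeasurableSet I →
      P {ω | M₁ ω + L ω ∈ I} ≤ ENNReal.ofReal (Real.exp ε) * P {ω | M₂ ω + L ω ∈ I} ∧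
      P {ω | M₂ ω + L ω ∈ I} ≤ ENNReal.ofReal (Real.exp ε) * P {ω | M₁ ω + L ω ∈ I} := by
  intro I hI
  have h₁ : IndepFun M₁ L P := (hindep.comp measurable_id measurable_fst).symm
  have h₂ : IndepFun M₂ L P := (hindep.comp measurable_id measurable_snd).symm
  exact ⟨measure_add_laplace_mem_le hε hk hM₁ hM₂ hL hbd hlaw h₁ h₂ hI,
    measure_add_laplace_mem_le hε hk hM₂ hM₁ hL
      (by simpa only [abs_sub_comm] using hbd) hlaw h₂ h₁ hI⟩
end

section
/- Let n ∈ ℕ, let w ∈ ℕ, and let p ∈ [0,1] with n·p ≤ w. Then for a random variable X with the binomial distribution Bin(n, p), Pr[X ≤ w] ≥ 1/2. -/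
open Finset in
theorem hasDerivAt_binomial_cdf (n w : ℕ) (p : ℝ) :
    HasDerivAt (fun p : ℝ => ∑ m ∈ range (w + 1), (n.choose m : ℝ) * p ^ m * (1 - p) ^ (n - m))
      (-((n.choose w : ℝ) * (n - w : ℕ) * (p ^ w * (1 - p) ^ (n - w - 1)))) p := by
  have hq (i : ℕ) : HasDerivAt (fun p : ℝ => (1 - p) ^ i) (-((i : ℝ) * (1 - p) ^ (i - 1))) p := by
    simpa using ((hasDerivAt_id p).const_sub 1).fun_pow i
  induction w with
  | zero => simpa using hq n
  | succ w ih =>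
    simp only [sum_range_succ _ (w + 1)]
    have hterm := ((hasDerivAt_pow (w + 1) p).const_mul (n.choose (w + 1) : ℝ)).mul (hq (n - (w + 1)))
    refine (ih.add hterm).congr_deriv ?_
    have hc : (n.choose (w + 1) : ℝ) * (w + 1) = n.choose w * (n - w : ℕ) := by
      exact_mod_cast Nat.choose_succ_right_eq n w
    rw [← hc, Nat.add_sub_cancel, ← Nat.sub_sub]
    push_cast
    ring

open Finset in
theorem binomial_cdf_nonneg (n w : ℕ) {p : ℝ} (hp0 : 0 ≤ p) (hp1 : p ≤ 1) :
    0 ≤ ∑ m ∈ range (w + 1), (n.choose m : ℝ) * p ^ m * (1 - p) ^ (n - m) := by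
  have : 0 ≤ 1 - p := sub_nonneg.2 hp1
  exact sum_nonneg fun m _ => by positivity

open Finset in
theorem binomial_cdf_antitoneOn (n w : ℕ) :
    AntitoneOn (fun p : ℝ => ∑ m ∈ range (w + 1), (n.choose m : ℝ) * p ^ m * (1 - p) ^ (n - m))
      (Set.Icc 0 1) := by
  refine antitoneOn_of_hasDerivWithinAt_nonpos (convex_Icc 0 1)
    (fun p _ => (hasDerivAt_binomial_cdf n w p).continuousAt.continuousWithinAt)
    (fun p _ => (hasDerivAt_binomial_cdf n w p).hasDerivWithinAt) fun p hp => ?_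
  rw [interior_Icc] at hp
  have h0 : 0 ≤ p := hp.1.le
  have h1 : 0 ≤ 1 - p := sub_nonneg.2 hp.2.le
  exact neg_nonpos.2 (by positivity)

open Finset in
theorem binomial_cdf_zero (n w : ℕ) :
    ∑ m ∈ range (w + 1), (n.choose m : ℝ) * 0 ^ m * (1 - 0) ^ (n - m) = 1 := by
  simp [sum_range_succ']

/-- For `p ≤ q`, the Beta weight `t ^ (n p) * (1 - t) ^ (n q)` is larger at `p + x`
than at `p - x`. -/
theorem pow_mul_pow_le_of_reflection {w k : ℕ} {p q x c : ℝ} (hc : 0 < c) (hw : (w : ℝ) = c * p)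
    (hk : (k : ℝ) = c * q) (hx : 0 ≤ x) (hxp : x < p) (hpq : p ≤ q) :
    (p - x) ^ w * (q + x) ^ k ≤ (p + x) ^ w * (q - x) ^ k := by
  have hmono : MonotoneOn (fun y : ℝ => w * (Real.log (p + y) - Real.log (p - y))
      - k * (Real.log (q + y) - Real.log (q - y))) (Set.Icc 0 x) := by
    have hd : ∀ y ∈ Set.Icc 0 x, HasDerivAt (fun y : ℝ => w * (Real.log (p + y) - Real.log (p - y))
      - k * (Real.log (q + y) - Real.log (q - y)))
        (w * (1 / (p + y) - (-1) / (p - y)) - k * (1 / (q + y) - (-1) / (q - y))) y := by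
      rintro y ⟨hy0, hyx⟩
      have hlog (a : ℝ) (ha : y < a) : HasDerivAt
          (fun y : ℝ => Real.log (a + y) - Real.log (a - y)) (1 / (a + y) - (-1) / (a - y)) y :=
        (((hasDerivAt_id y).const_add a).log (by simp; linarith)).sub
          (((hasDerivAt_id y).const_sub a).log (by simp; linarith))
      exact ((hlog p (by linarith)).const_mul _).sub ((hlog q (by linarith)).const_mul _)
    refine monotoneOn_of_hasDerivWithinAt_nonneg (convex_Icc 0 x)
      (fun y hy => (hd y hy).continuousAt.continuousWithinAt)
      (fun y hy => (hd y (interior_subset hy)).hasDerivWithinAt) fun y hy => ?_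
    obtain ⟨hy0, hyx⟩ := interior_subset hy
    have h1 : 0 < p - y := by linarith
    have h2 : 0 < q - y := by linarith
    have h3 : 0 < p + y := by linarith
    have h4 : 0 < q + y := by linarith
    have he : w * (1 / (p + y) - (-1) / (p - y)) - k * (1 / (q + y) - (-1) / (q - y))
        = 2 * c * y ^ 2 * ((q - p) * (q + p)) / ((p + y) * (p - y) * ((q + y) * (q - y))) := by
      rw [hw, hk]
      field_simp
      ring
    rw [he]
    have h5 : 0 ≤ q - p := by linarith
    have h6 : 0 ≤ q + p := by linarith
    positivity
  have h := hmono (Set.left_mem_Icc.2 hx) (Set.right_mem_Icc.2 hx) hx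
  simp only [add_zero, sub_zero, sub_self, mul_zero] at h
  have h1 : 0 < p - x := by linarith
  have h2 : 0 < q - x := by linarith
  have h3 : 0 < p + x := by linarith
  have h4 : 0 < q + x := by linarith
  rw [← Real.log_le_log_iff (by positivity) (by positivity), Real.log_mul (by positivity)
    (by positivity), Real.log_mul (by positivity) (by positivity)]
  simp only [Real.log_pow]
  linarith

theorem pow_mul_pow_le_of_inversion {w j : ℕ} {b : ℝ} (hjw : j + 1 ≤ w) (hb : 0 < b) (hb1 : b ≤ 1) :
    b ^ w * ((j + 1) * b + w) ^ (w + j + 2) ≤ b ^ j * ((j + 1) + w * b) ^ (w + j + 2) := by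
  have hjw' : (j : ℝ) + 1 ≤ w := by exact_mod_cast hjw
  have hj : (0 : ℝ) ≤ j := j.cast_nonneg
  have hw : (0 : ℝ) < w := by linarith
  have hanti : AntitoneOn (fun y : ℝ => (w + j + 2) * (Real.log ((j + 1) + w * y)
      - Real.log ((j + 1) * y + w)) - (w - j) * Real.log y) (Set.Icc b 1) := by
    have hd : ∀ y ∈ Set.Icc b 1, HasDerivAt (fun y : ℝ => (w + j + 2) * (Real.log ((j + 1) + w * y)
        - Real.log ((j + 1) * y + w)) - (w - j) * Real.log y)
        ((w + j + 2) * (w * 1 / ((j + 1) + w * y) - (j + 1) * 1 / ((j + 1) * y + w))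
          - (w - j) * (1 / y)) y := by
      rintro y ⟨hy0, hy1⟩
      have hy : 0 < y := by linarith
      exact (((((hasDerivAt_id y).const_mul (w : ℝ)).const_add ((j : ℝ) + 1)).log
          (by simp only [id]; positivity)).sub
        ((((hasDerivAt_id y).const_mul ((j : ℝ) + 1)).add_const (w : ℝ)).log
          (by simp only [id]; positivity))).const_mul ((w : ℝ) + j + 2) |>.sub
        (((hasDerivAt_id y).log hy.ne').const_mul ((w : ℝ) - j))
    refine antitoneOn_of_hasDerivWithinAt_nonpos (convex_Icc b 1)
      (fun y hy => (hd y hy).continuousAt.continuousWithinAt)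
      (fun y hy => (hd y (interior_subset hy)).hasDerivWithinAt) fun y hy => ?_
    obtain ⟨hy0, hy1⟩ := interior_subset hy
    have hy : 0 < y := by linarith
    have he : (w + j + 2) * (w * 1 / ((j + 1) + w * y) - (j + 1) * 1 / ((j + 1) * y + w))
          - (w - j) * (1 / y) = -((w - j) * ((j + 1) * w * (1 - y) ^ 2)
            + 2 * (j + 1) * (w + j + 1) * y) / (y * ((j + 1) + w * y) * ((j + 1) * y + w)) := by
      field_simp
      ring
    rw [he]
    have h5 : 0 ≤ (w : ℝ) - j := by linarith
    exact div_nonpos_of_nonpos_of_nonneg (neg_nonpos.2 (by positivity)) (by positivity)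
  have h := hanti (Set.left_mem_Icc.2 hb1) (Set.right_mem_Icc.2 hb1) hb1
  simp only [mul_one, Real.log_one, mul_zero, sub_self] at h
  rw [← Real.log_le_log_iff (by positivity) (by positivity), Real.log_mul (by positivity)
    (by positivity), Real.log_mul (by positivity) (by positivity)]
  simp only [Real.log_pow]
  push_cast
  linarith

open Finset in
theorem half_le_binomial_cdf_of_le {w j : ℕ} (hwj : w ≤ j + 1) :
    (1 : ℝ) / 2 ≤ ∑ m ∈ range (w + 1), ((w + j + 1).choose m : ℝ) *
      ((w : ℝ) / (w + j + 1)) ^ m * (1 - (w : ℝ) / (w + j + 1)) ^ (w + j + 1 - m) := by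
  set n := w + j + 1 with hn
  set p : ℝ := (w : ℝ) / (w + j + 1) with hp
  set F : ℝ → ℝ := fun p => ∑ m ∈ range (w + 1), (n.choose m : ℝ) * p ^ m * (1 - p) ^ (n - m)
    with hF
  have hwj' : (w : ℝ) ≤ j + 1 := by exact_mod_cast hwj
  have hp0 : 0 ≤ p := by positivity
  have hp2 : p ≤ 1 - p := by
    have : 2 * p ≤ 1 := by
      rw [hp, ← mul_div_assoc, div_le_one (by positivity)]
      linarith
    linarith
  have hanti : AntitoneOn (fun x => F (p - x) + F (p + x)) (Set.Icc 0 p) := by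
    have hd (x : ℝ) := ((hasDerivAt_binomial_cdf n w (p - x)).comp x
      ((hasDerivAt_id x).const_sub p)).add ((hasDerivAt_binomial_cdf n w (p + x)).comp x
      ((hasDerivAt_id x).const_add p))
    refine antitoneOn_of_hasDerivWithinAt_nonpos (convex_Icc 0 p)
      (fun x _ => (hd x).continuousAt.continuousWithinAt)
      (fun x _ => (hd x).hasDerivWithinAt) fun x hx => ?_
    rw [interior_Icc] at hx
    obtain ⟨hx0, hxp⟩ := hx
    have key := pow_mul_pow_le_of_reflection (w := w) (k := j + 1) (p := p) (q := 1 - p) (x := x)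
      (c := w + j + 1) (by positivity) (by rw [hp]; field_simp)
      (by rw [hp]; push_cast; field_simp; ring) hx0.le hxp hp2
    have hsub : n - w - 1 = j := by omega
    have hle : (p - x) ^ w * (1 - (p - x)) ^ j ≤ (p + x) ^ w * (1 - (p + x)) ^ j := by
      have e1 : 1 - (p - x) = 1 - p + x := by ring
      have e2 : 1 - (p + x) = 1 - p - x := by ring
      rw [e1, e2]
      have h1 : 0 < 1 - p - x := by linarith
      have h2 : 0 < 1 - p + x := by linarith
      have h3 : 0 < p - x := by linarith
      have h4 : 0 < p + x := by linarith
      refine le_of_mul_le_mul_right ?_ h2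
      calc (p - x) ^ w * (1 - p + x) ^ j * (1 - p + x)
          = (p - x) ^ w * (1 - p + x) ^ (j + 1) := by ring
        _ ≤ (p + x) ^ w * (1 - p - x) ^ (j + 1) := key
        _ = (p + x) ^ w * (1 - p - x) ^ j * (1 - p - x) := by ring
        _ ≤ (p + x) ^ w * (1 - p - x) ^ j * (1 - p + x) := by gcongr; linarith
    rw [hsub]
    have hC : (0 : ℝ) ≤ (n.choose w : ℝ) * (n - w : ℕ) := by positivity
    have := mul_le_mul_of_nonneg_left hle hC
    linarith
  have h := hanti (Set.left_mem_Icc.2 hp0) (Set.right_mem_Icc.2 hp0) hp0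
  have hF0 : F 0 = 1 := binomial_cdf_zero n w
  have hF2 : 0 ≤ F (p + p) := binomial_cdf_nonneg n w (by linarith) (by linarith)
  simp only [sub_self, sub_zero, add_zero, hF0] at h
  change 1 / 2 ≤ F p
  linarith

open Finset in
theorem half_le_binomial_cdf_of_ge {w j : ℕ} (hjw : j + 1 ≤ w) :
    (1 : ℝ) / 2 ≤ ∑ m ∈ range (w + 1), ((w + j + 1).choose m : ℝ) *
      ((w : ℝ) / (w + j + 1)) ^ m * (1 - (w : ℝ) / (w + j + 1)) ^ (w + j + 1 - m) := by
  set n := w + j + 1 with hn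
  set F : ℝ → ℝ := fun p => ∑ m ∈ range (w + 1), (n.choose m : ℝ) * p ^ m * (1 - p) ^ (n - m)
    with hF
  have hw : (0 : ℝ) < w := by exact_mod_cast (by omega : 0 < w)
  have hmono : MonotoneOn
      (fun b : ℝ => F (w / ((j + 1) * b + w)) + F (w * b / ((j + 1) + w * b))) (Set.Icc 0 1) := by
    have h1 (b : ℝ) (hb : b ∈ Set.Icc (0 : ℝ) 1) : HasDerivAt
        (fun b : ℝ => (w : ℝ) / ((j + 1) * b + w)) (-((j + 1) * w / ((j + 1) * b + w) ^ 2)) b := by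
      have hb0 := hb.1
      refine ((hasDerivAt_const b (w : ℝ)).fun_div
        (((hasDerivAt_id b).const_mul ((j : ℝ) + 1)).add_const (w : ℝ))
        (by simp only [id]; positivity)).congr_deriv ?_
      simp only [id]
      ring
    have h2 (b : ℝ) (hb : b ∈ Set.Icc (0 : ℝ) 1) : HasDerivAt
        (fun b : ℝ => (w : ℝ) * b / ((j + 1) + w * b))
        ((j + 1) * w / ((j + 1) + w * b) ^ 2) b := by
      have hb0 := hb.1
      refine (((hasDerivAt_id b).const_mul (w : ℝ)).fun_div
        (((hasDerivAt_id b).const_mul (w : ℝ)).const_add ((j : ℝ) + 1))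
        (by simp only [id]; positivity)).congr_deriv ?_
      simp only [id]
      ring
    have hd (b : ℝ) (hb : b ∈ Set.Icc (0 : ℝ) 1) :=
      ((hasDerivAt_binomial_cdf n w _).comp b (h1 b hb)).add
        ((hasDerivAt_binomial_cdf n w _).comp b (h2 b hb))
    refine monotoneOn_of_hasDerivWithinAt_nonneg (convex_Icc 0 1)
      (fun b hb => (hd b hb).continuousAt.continuousWithinAt)
      (fun b hb => (hd b (interior_subset hb)).hasDerivWithinAt) fun b hb => ?_
    rw [interior_Icc] at hb
    obtain ⟨hb0, hb1⟩ := hb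
    have key := pow_mul_pow_le_of_inversion hjw hb0 hb1.le
    have hsub : n - w - 1 = j := by omega
    set A : ℝ := (j + 1) * b + w with hA
    set B : ℝ := (j + 1) + w * b with hB
    have hA0 : 0 < A := by positivity
    have hB0 : 0 < B := by positivity
    have e1 : 1 - w / A = (j + 1) * b / A := by
      rw [eq_div_iff hA0.ne', sub_mul, div_mul_cancel₀ _ hA0.ne', hA]
      ring
    have e2 : 1 - w * b / B = (j + 1) / B := by
      rw [eq_div_iff hB0.ne', sub_mul, div_mul_cancel₀ _ hB0.ne', hB]
      ring
    have hle : (w * b / B) ^ w * (1 - w * b / B) ^ j * ((j + 1) * w / B ^ 2) ≤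
        (w / A) ^ w * (1 - w / A) ^ j * ((j + 1) * w / A ^ 2) := by
      rw [e1, e2]
      have l : (w * b / B) ^ w * ((j + 1) / B) ^ j * ((j + 1) * w / B ^ 2)
          = (w : ℝ) ^ (w + 1) * (j + 1) ^ (j + 1) * (b ^ w / B ^ (w + j + 2)) := by
        simp only [div_pow, mul_pow, pow_add]
        field_simp
      have r : (w / A) ^ w * ((j + 1) * b / A) ^ j * ((j + 1) * w / A ^ 2)
          = (w : ℝ) ^ (w + 1) * (j + 1) ^ (j + 1) * (b ^ j / A ^ (w + j + 2)) := by
        simp only [div_pow, mul_pow, pow_add]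
        field_simp
      rw [l, r]
      refine mul_le_mul_of_nonneg_left ?_ (by positivity)
      rw [div_le_div_iff₀ (by positivity) (by positivity)]
      exact key
    rw [hsub]
    have hC : (0 : ℝ) ≤ (n.choose w : ℝ) * (n - w : ℕ) := by positivity
    have := mul_le_mul_of_nonneg_left hle hC
    linarith
  have h := hmono (Set.left_mem_Icc.2 zero_le_one) (Set.right_mem_Icc.2 zero_le_one) zero_le_one
  have hF0 : F 0 = 1 := binomial_cdf_zero n w
  have hF1 : 0 ≤ F 1 := binomial_cdf_nonneg n w zero_le_one le_rfl
  have e : (w : ℝ) / (w + j + 1) = w / (j + 1 + w) := by ring_nf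
  simp only [mul_zero, zero_add, zero_div, mul_one, div_self hw.ne', hF0] at h
  change 1 / 2 ≤ F _
  rw [e]
  linarith

/-- If `n·p ≤ w`, then a `Bin(n, p)` random variable is at most `w` with probability
at least `1/2`: the binomial CDF at `w` is at least `1/2`. -/
theorem binomial_cdf_ge_half (n w : ℕ) (p : ℝ) (hp0 : 0 ≤ p) (hp1 : p ≤ 1)
    (h : (n : ℝ) * p ≤ w) :
    (1 : ℝ) / 2 ≤
      ∑ m ∈ Finset.range (w + 1), (n.choose m : ℝ) * p ^ m * (1 - p) ^ (n - m) := by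
  rcases le_or_gt n w with hnw | hnw
  · have hq : 0 ≤ 1 - p := sub_nonneg.2 hp1
    calc (1 : ℝ) / 2 ≤ (p + (1 - p)) ^ n := by norm_num
      _ = ∑ m ∈ Finset.range (n + 1), (n.choose m : ℝ) * p ^ m * (1 - p) ^ (n - m) := by
        rw [add_pow]
        exact Finset.sum_congr rfl fun m _ => by ring
      _ ≤ _ := Finset.sum_le_sum_of_subset_of_nonneg
        (Finset.range_subset_range.2 (by omega)) fun m _ _ => by positivity
  · obtain ⟨j, rfl⟩ := Nat.exists_eq_add_of_lt hnw
    have hn : (0 : ℝ) < w + j + 1 := by positivity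
    have hpw : p ≤ (w : ℝ) / (w + j + 1) := by
      rw [le_div_iff₀ hn, mul_comm]
      exact_mod_cast h
    have hw1 : (w : ℝ) / (w + j + 1) ≤ 1 := by
      rw [div_le_one hn]
      linarith [(j.cast_nonneg : (0 : ℝ) ≤ j)]
    refine le_trans ?_ (binomial_cdf_antitoneOn (w + j + 1) w ⟨hp0, hp1⟩
      ⟨hp0.trans hpw, hw1⟩ hpw)
    rcases le_total w (j + 1) with hwj | hjw
    · exact half_le_binomial_cdf_of_le hwj
    · exact half_le_binomial_cdf_of_ge hjw
end

section
/- Let x̄ : ℝ → ℝ be an antitone (nonincreasing) nonnegative function that is integrable on [v, ∞) for every v ∈ ℝ, and define the payment function p : ℝ → ℝ by p(v) = v·x̄(v) + ∫_{v}^{∞} x̄(t) dt. Then the incentive-compatibility inequalities hold: for all v, v' ∈ ℝ, p(v) − v·x̄(v) ≥ p(v') − v·x̄(v'); equivalently, ∫_{v}^{∞} x̄(t) dt ≥ ∫_{v'}^{∞} x̄(t) dt + (v' − v)·x̄(v'). -/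
open MeasureTheory

/-- The oriented integral of an antitone function over `a..b` is at least the signed length of
the interval times the value at the upper endpoint `b`. -/
theorem Antitone.sub_mul_le_intervalIntegral {f : ℝ → ℝ} (hf : Antitone f) (a b : ℝ) :
    (b - a) * f b ≤ ∫ t in a..b, f t := by
  have hconst (c d : ℝ) : ∫ _ in c..d, f b = (d - c) * f b := by
    rw [intervalIntegral.integral_const, smul_eq_mul]
  rcases le_total a b with h | h
  · rw [← hconst]
    exact intervalIntegral.integral_mono_on h intervalIntegrable_const hf.intervalIntegrable
      fun x hx => hf hx.2
  · have key : ∫ t in b..a, f t ≤ ∫ _ in b..a, f b :=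
      intervalIntegral.integral_mono_on h hf.intervalIntegrable intervalIntegrable_const
        fun x hx => hf hx.1
    rw [hconst] at key
    rw [intervalIntegral.integral_symm]
    linarith

/-- Myerson payments are incentive compatible: if `x̄` is antitone, nonnegative and
integrable on every `[v, ∞)`, and `p v = v·x̄ v + ∫_v^∞ x̄`, then reporting truthfully
maximizes the utility `p v − v·x̄ v`. -/
theorem myerson_payment_incentive_compatible
    (xbar : ℝ → ℝ) (hmono : Antitone xbar) (hnonneg : ∀ v, 0 ≤ xbar v)
    (hint : ∀ v : ℝ, IntegrableOn xbar (Set.Ici v) volume)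
    (p : ℝ → ℝ) (hp : ∀ v, p v = v * xbar v + ∫ t in Set.Ioi v, xbar t) :
    ∀ v v' : ℝ, p v' - v * xbar v' ≤ p v - v * xbar v := by
  intro v v'
  have hIoi (w : ℝ) : IntegrableOn xbar (Set.Ioi w) := (hint w).mono_set Set.Ioi_subset_Ici_self
  have hsub := intervalIntegral.integral_Ioi_sub_Ioi' (hIoi v) (hIoi v')
  have hle := hmono.sub_mul_le_intervalIntegral v v'
  rw [hp v, hp v']
  linarith
end

section
/- Let x̄ : ℝ → ℝ and p : ℝ → ℝ be differentiable functions satisfying the incentive-compatibility inequalities (for all v, v', p(v) − v·x̄(v) ≥ p(v') − v·x̄(v')), such that x̄ is integrable on [v, ∞) for every v, lim_{v→∞} x̄(v) = 0, lim_{v→∞} p(v) = 0, and lim_{v→∞} v·x̄(v) = 0. Then the payment formula holds: for every v ∈ ℝ, p(v) = v·x̄(v) + ∫_{v}^{∞} x̄(t) dt. -/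
open MeasureTheory Filter

/-- The indirect utility `p v - v * x v` of a differentiable incentive-compatible mechanism has
derivative `-x`; equivalently its negation has derivative `x`. -/
theorem hasDerivAt_mul_sub_of_incentive_compatible {x p : ℝ → ℝ} (hx : Differentiable ℝ x)
    (hp : Differentiable ℝ p) (hIC : ∀ v v' : ℝ, p v' - v * x v' ≤ p v - v * x v) (v : ℝ) :
    HasDerivAt (fun t => t * x t - p t) (x v) v := by
  have hmax : IsLocalMax (fun t => p t - v * x t) v := Eventually.of_forall (hIC v)
  have hfoc : deriv p v - v * deriv x v = 0 :=
    hmax.hasDerivAt_eq_zero ((hp v).hasDerivAt.sub ((hx v).hasDerivAt.const_mul v))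
  refine (((hasDerivAt_id' v).mul (hx v).hasDerivAt).sub (hp v).hasDerivAt).congr_deriv ?_
  linarith

/-- For a differentiable incentive-compatible mechanism with vanishing allocation and
payment at infinity, the payment is uniquely determined by the Myerson formula
`p v = v·x̄ v + ∫_v^∞ x̄`. -/
theorem payment_formula_of_incentive_compatible
    (xbar p : ℝ → ℝ) (hx : Differentiable ℝ xbar) (hpdiff : Differentiable ℝ p)
    (hIC : ∀ v v' : ℝ, p v' - v * xbar v' ≤ p v - v * xbar v)
    (hint : ∀ v : ℝ, IntegrableOn xbar (Set.Ici v) volume)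
    (hxlim : Tendsto xbar atTop (nhds 0))
    (hplim : Tendsto p atTop (nhds 0))
    (hvxlim : Tendsto (fun v => v * xbar v) atTop (nhds 0)) :
    ∀ v : ℝ, p v = v * xbar v + ∫ t in Set.Ioi v, xbar t := by
  intro v
  have hlim : Tendsto (fun t => t * xbar t - p t) atTop (nhds 0) := by
    simpa using hvxlim.sub hplim
  have hftc := integral_Ioi_of_hasDerivAt_of_tendsto'
    (fun t _ => hasDerivAt_mul_sub_of_incentive_compatible hx hpdiff hIC t)
    ((hint v).mono_set Set.Ioi_subset_Ici_self) hlim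
  linarith
end

section
/- Let a ≤ b be reals, let x̄ : ℝ → ℝ be a bounded measurable function, let f : ℝ → ℝ be a nonnegative function integrable on [a, b], let F(v) := ∫_{a}^{v} f(t) dt, and define p(v) := v·x̄(v) + ∫_{v}^{b} x̄(t) dt. Then the expected payment equals the expected virtual cost: ∫_{a}^{b} p(v)·f(v) dv = ∫_{a}^{b} x̄(v)·( v·f(v) + F(v) ) dv. -/
open MeasureTheory intervalIntegral

/-- Exchanging the order of integration over the triangle `a ≤ v ≤ t ≤ b`. -/
theorem intervalIntegral_integral_tail_mul_eq_mul_integral_head {a b : ℝ} {f g : ℝ → ℝ}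
    (hf : IntervalIntegrable f volume a b) (hg : IntervalIntegrable g volume a b) :
    ∫ v in a..b, (∫ t in v..b, g t) * f v = ∫ v in a..b, g v * ∫ t in a..v, f t := by
  have hF := hf.absolutelyContinuousOnInterval_intervalIntegral Set.left_mem_uIcc
  have hG := hg.absolutelyContinuousOnInterval_intervalIntegral Set.right_mem_uIcc
  have parts := hG.integral_mul_deriv_eq_deriv_mul hF
  simp only [integral_same, zero_mul, mul_zero, sub_self, zero_sub] at parts
  have left_eq : ∫ v in a..b, (∫ t in v..b, g t) * f v =
      -∫ v in a..b, (∫ t in b..v, g t) * deriv (fun x => ∫ t in a..x, f t) v := by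
    rw [← intervalIntegral.integral_neg]
    refine integral_congr_ae ?_
    filter_upwards [hf.ae_hasDerivAt_integral] with v hv hvab
    rw [(hv (Set.uIoc_subset_uIcc hvab) a Set.left_mem_uIcc).deriv, integral_symm b v, neg_mul]
  rw [left_eq, parts, neg_neg]
  refine integral_congr_ae ?_
  filter_upwards [hg.ae_hasDerivAt_integral] with v hv hvab
  rw [(hv (Set.uIoc_subset_uIcc hvab) b Set.right_mem_uIcc).deriv]

/-- The expected Myerson payment equals the expected virtual cost:
`∫_a^b p(v) f(v) dv = ∫_a^b x̄(v) (v f(v) + F(v)) dv`, where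
`F(v) = ∫_a^v f` and `p(v) = v·x̄(v) + ∫_v^b x̄`. -/
theorem expected_payment_eq_expected_virtual_cost
    (a b : ℝ) (hab : a ≤ b)
    (xbar : ℝ → ℝ) (hxmeas : Measurable xbar) (C : ℝ) (hxbd : ∀ v, |xbar v| ≤ C)
    (f : ℝ → ℝ) (hf0 : ∀ v, 0 ≤ f v) (hfint : IntervalIntegrable f volume a b) :
    ∫ v in a..b, (v * xbar v + ∫ t in v..b, xbar t) * f v =
      ∫ v in a..b, xbar v * (v * f v + ∫ t in a..v, f t) := by
  have hx : IntervalIntegrable xbar volume a b :=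
    (intervalIntegrable_const (c := C)).mono_fun' hxmeas.aestronglyMeasurable
      (Filter.Eventually.of_forall hxbd)
  have hvf : IntervalIntegrable (fun v => v * f v) volume a b :=
    hfint.continuousOn_mul continuousOn_id
  have hxvf : IntervalIntegrable (fun v => xbar v * (v * f v)) volume a b := by
    rw [intervalIntegrable_iff] at hvf ⊢
    exact hvf.bdd_mul hxmeas.aestronglyMeasurable (Filter.Eventually.of_forall hxbd)
  have hF := (hfint.absolutelyContinuousOnInterval_intervalIntegral
    Set.left_mem_uIcc).continuousOn
  have hG := (hx.absolutelyContinuousOnInterval_intervalIntegral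
    Set.right_mem_uIcc).continuousOn
  have hGf : IntervalIntegrable (fun v => (∫ t in v..b, xbar t) * f v) volume a b := by
    simp_rw [fun v => integral_symm (f := xbar) (μ := volume) b v]
    exact hfint.continuousOn_mul hG.neg
  calc ∫ v in a..b, (v * xbar v + ∫ t in v..b, xbar t) * f v
      = ∫ v in a..b, (xbar v * (v * f v) + (∫ t in v..b, xbar t) * f v) := by
        congr 1 with v
        ring
    _ = (∫ v in a..b, xbar v * (v * f v)) + ∫ v in a..b, xbar v * ∫ t in a..v, f t := by
        rw [integral_add hxvf hGf, intervalIntegral_integral_tail_mul_eq_mul_integral_head hfint hx]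
    _ = ∫ v in a..b, xbar v * (v * f v + ∫ t in a..v, f t) := by
        rw [← integral_add hxvf (hx.mul_continuousOn hF)]
        simp_rw [mul_add]
end
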